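/- Let f be a minmax monotone cost function on a finite tree T_in, 𝒯 ≥ 0, and let T = (V,E) be a working subtree with sink set S ⊆ V with |S| ≥ 2 and |V| > 2, rooted so that the hub tree T_{H(S)} is defined. If no ordered pair (u,v) ∈ V × V satisfies the peaking criterion, then T is RC-viable with respect to S, i.e., for every outstanding branch T' = (V',E') attached to a node w ∈ V_{H(S)} one has f(V' ∪ {w}, w) ≤ 𝒯. -/

import Mathlib

open SimpleGraph Set
open scoped ENNReal

variable {V : Type*}

/-- The vertex set of the connected component of the subgraph of `G` induced on `A`
containing the vertex `u` (empty if `u ∉ A`). -/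
def reachSet (G : SimpleGraph V) (A : Set V) (u : V) : Set V :=
  {y | ∃ (hu : u ∈ A) (hy : y ∈ A), (G.induce A).Reachable ⟨u, hu⟩ ⟨y, hy⟩}

/-- `U` is a subtree: the induced subgraph on `U` is connected. -/
def IsSubtree (G : SimpleGraph V) (U : Set V) : Prop :=
  (G.induce U).Connected

/-- A minmax monotone cost function on the tree `G`:
`f {s} s = 0`; `f U s = ∞` if `U` is not a subtree or `s ∉ U`; set monotonicity;
path monotonicity; and max tree composition (the slices of `U` defined by `s` being the
connected components of `U \ {s}`). -/
structure IsMinmaxMonotone (G : SimpleGraph V) (f : Set V → V → ℝ≥0∞) : Prop where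
  singleton_eq_zero : ∀ s : V, f {s} s = 0
  eq_top_of_not_subtree : ∀ (U : Set V) (s : V), ¬ IsSubtree G U → f U s = ⊤
  eq_top_of_not_mem : ∀ (U : Set V) (s : V), s ∉ U → f U s = ⊤
  set_mono : ∀ (U₁ U₂ : Set V) (s : V), IsSubtree G U₁ → IsSubtree G U₂ →
    s ∈ U₁ → U₁ ⊆ U₂ → f U₁ s ≤ f U₂ s
  path_mono : ∀ (U : Set V) (s u : V), IsSubtree G U → s ∉ U → u ∈ U → G.Adj s u →
    f U u ≤ f (U ∪ {s}) s
  max_comp : ∀ (U : Set V) (s : V), IsSubtree G U → s ∈ U →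
    f U s = ⨆ x ∈ U \ {s}, f (reachSet G (U \ {s}) x ∪ {s}) s

/-- `s` is a leaf of the (working) tree induced on `W`. -/
def IsLeafOf (G : SimpleGraph V) (W : Set V) (s : V) : Prop :=
  s ∈ W ∧ ∃! u, u ∈ W ∧ G.Adj s u

/-- The ordered pair `(u,v)` satisfies the peaking criterion in the working tree on `W`
with sink set `S` and threshold `𝒯`. -/
def PeakingPair (G : SimpleGraph V) (f : Set V → V → ℝ≥0∞) (𝒯 : ℝ≥0∞)
    (W S : Set V) (u v : V) : Prop :=
  u ∈ W ∧ v ∈ W ∧ G.Adj u v ∧ S ∩ reachSet G (W \ {v}) u = ∅ ∧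
    f (reachSet G (W \ {v}) u) u ≤ 𝒯 ∧ 𝒯 < f (reachSet G (W \ {v}) u ∪ {v}) v

/-- `w` lies on the unique path from `a` to `b` in the tree induced on `W`. -/
def OnPath (G : SimpleGraph V) (W : Set V) (a b w : V) : Prop :=
  a ∈ W ∧ b ∈ W ∧ w ∈ W ∧ b ∉ reachSet G (W \ {w}) a

/-- Vertices of the hub tree: union of the paths from the sinks to the root `r`. -/
def hubVerts (G : SimpleGraph V) (W S : Set V) (r : V) : Set V :=
  {w | ∃ s ∈ S, OnPath G W s r w}

/-- `r` is a valid root: a non-sink vertex of the working tree such that at least two of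
the subtrees hanging off it contain sinks. -/
def GoodRoot (G : SimpleGraph V) (W S : Set V) (r : V) : Prop :=
  r ∈ W ∧ r ∉ S ∧
    ∃ η₁ η₂ : V, η₁ ≠ η₂ ∧ η₁ ∈ W ∧ η₂ ∈ W ∧ G.Adj r η₁ ∧ G.Adj r η₂ ∧
      (S ∩ reachSet G (W \ {r}) η₁).Nonempty ∧ (S ∩ reachSet G (W \ {r}) η₂).Nonempty

/-- The working tree on `W` is RC-viable w.r.t. sinks `S` and root `r`: every outstanding
branch, together with the hub-tree node it is attached to, has cost at most `𝒯`. -/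
def RCViable (G : SimpleGraph V) (f : Set V → V → ℝ≥0∞) (𝒯 : ℝ≥0∞)
    (W S : Set V) (r : V) : Prop :=
  ∀ w ∈ hubVerts G W S r, ∀ η ∈ W, G.Adj w η → η ∉ hubVerts G W S r →
    f (reachSet G (W \ {w}) η ∪ {w}) w ≤ 𝒯

/-- The set `A` is self-sufficient: it can be partitioned into subtree blocks, one for
each sink in `S ∩ A`, each block containing its sink and having cost at most `𝒯`. -/
def SelfSufficient (G : SimpleGraph V) (f : Set V → V → ℝ≥0∞) (𝒯 : ℝ≥0∞)
    (S A : Set V) : Prop :=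
  ∃ P : V → Set V,
    (⋃ s ∈ S ∩ A, P s) = A ∧
    (∀ s ∈ S ∩ A, IsSubtree G (P s) ∧ s ∈ P s ∧ f (P s) s ≤ 𝒯) ∧
    (S ∩ A).Pairwise fun s t => Disjoint (P s) (P t)

/-- The vertices of the path `Π(a,b)` in the tree induced on `W`. -/
def pathSet (G : SimpleGraph V) (W : Set V) (a b : V) : Set V :=
  {w | OnPath G W a b w}

/-- All vertices of outstanding branches attached to `w` (given hub-tree vertices `Hub`). -/
def branchesAt (G : SimpleGraph V) (W Hub : Set V) (w : V) : Set V :=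
  ⋃ η ∈ {η : V | η ∈ W ∧ G.Adj w η ∧ η ∉ Hub}, reachSet G (W \ {w}) η

/-- The bulk path `BP(a,b)`: the path `Π(a,b)` together with all outstanding branches
attached to its vertices. -/
def bulkPath (G : SimpleGraph V) (W S : Set V) (r a b : V) : Set V :=
  pathSet G W a b ∪ ⋃ w ∈ pathSet G W a b, branchesAt G W (hubVerts G W S r) w

/-- `v` is the parent of `u` in the hub tree rooted at `r`. -/
def HubParent (G : SimpleGraph V) (W S : Set V) (r u v : V) : Prop :=
  u ∈ hubVerts G W S r ∧ v ∈ hubVerts G W S r ∧ G.Adj u v ∧ OnPath G W u r v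

/-- The ordered pair `(u,v)` satisfies the reaching criterion: `v` is the hub-tree parent
of `u`, `T₋ᵥ(u)` is self-sufficient, and `BP(v,v) ∪ V₋ᵥ(u)` is not self-sufficient. -/
def ReachingPair (G : SimpleGraph V) (f : Set V → V → ℝ≥0∞) (𝒯 : ℝ≥0∞)
    (W S : Set V) (r u v : V) : Prop :=
  HubParent G W S r u v ∧
  SelfSufficient G f 𝒯 S (reachSet G (W \ {v}) u) ∧
  ¬ SelfSufficient G f 𝒯 S (bulkPath G W S r v v ∪ reachSet G (W \ {v}) u)

/-- The vertex set `V(v)` of the subtree of the working tree (rooted at `r`) rooted at `v`: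
all vertices whose path to the root passes through `v`. -/
def rootedBelow (G : SimpleGraph V) (W : Set V) (r v : V) : Set V :=
  {x | OnPath G W x r v}

/-- The rooted subtree `T(v)` is RC-viable: every outstanding branch attached to a
hub-tree node lying in `T(v)` has, together with its attachment node, cost at most `𝒯`. -/
def RCViableBelow (G : SimpleGraph V) (f : Set V → V → ℝ≥0∞) (𝒯 : ℝ≥0∞)
    (W S : Set V) (r v : V) : Prop :=
  ∀ w ∈ hubVerts G W S r ∩ rootedBelow G W r v, ∀ η ∈ W, G.Adj w η →
    η ∉ hubVerts G W S r → f (reachSet G (W \ {w}) η ∪ {w}) w ≤ 𝒯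

/-- The subtree with vertex set `A` (of the working tree rooted at `r`) is recursively
self-sufficient: for every hub-tree node `w` in `A`, the part of `A` lying below `w`
is self-sufficient. -/
def RecursivelySelfSufficientOn (G : SimpleGraph V) (f : Set V → V → ℝ≥0∞) (𝒯 : ℝ≥0∞)
    (W S : Set V) (r : V) (A : Set V) : Prop :=
  ∀ w ∈ hubVerts G W S r ∩ A, SelfSufficient G f 𝒯 S (rootedBelow G W r w ∩ A)

/-- A feasible sink configuration: a partition of all of `V_in` into subtree blocks,
one per sink, each block containing exactly its own sink and having cost at most `𝒯`. -/
def IsFeasibleConfig (G : SimpleGraph V) (f : Set V → V → ℝ≥0∞) (𝒯 : ℝ≥0∞)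
    (St : Set V) (P : V → Set V) : Prop :=
  (⋃ s ∈ St, P s) = Set.univ ∧
  St.Pairwise (fun s t => Disjoint (P s) (P t)) ∧
  ∀ s ∈ St, IsSubtree G (P s) ∧ St ∩ P s = {s} ∧ f (P s) s ≤ 𝒯

/-- An optimal feasible sink configuration: one with the minimum number of sinks. -/
def IsOptimalConfig (G : SimpleGraph V) (f : Set V → V → ℝ≥0∞) (𝒯 : ℝ≥0∞)
    (St : Set V) (P : V → Set V) : Prop :=
  IsFeasibleConfig G f 𝒯 St P ∧
  ∀ (St' : Set V) (P' : V → Set V), IsFeasibleConfig G f 𝒯 St' P' → St.ncard ≤ St'.ncard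

/-- A partial sink configuration relative to the working tree on `W`: pairwise disjoint
subtree blocks of cost at most `𝒯`, one per sink of `Sout`, covering `V_in \ (W \ Sout)`. -/
def IsPartialConfig (G : SimpleGraph V) (f : Set V → V → ℝ≥0∞) (𝒯 : ℝ≥0∞)
    (W : Set V) (Sout : Set V) (P : V → Set V) : Prop :=
  Sout.Pairwise (fun s t => Disjoint (P s) (P t)) ∧
  (∀ s ∈ Sout, IsSubtree G (P s) ∧ s ∈ P s ∧ f (P s) s ≤ 𝒯) ∧
  (⋃ s ∈ Sout, P s) = Set.univ \ (W \ Sout)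

/-- `(St, Pt)` is an optimal feasible sink configuration witnessing the optimality of the
partial configuration `(Sout, P)` relative to the working tree on `W` (conditions (C1)-(C3)). -/
def WitnessesOptimality (G : SimpleGraph V) (f : Set V → V → ℝ≥0∞) (𝒯 : ℝ≥0∞)
    (W : Set V) (Sout : Set V) (P : V → Set V) (St : Set V) (Pt : V → Set V) : Prop :=
  IsOptimalConfig G f 𝒯 St Pt ∧
  Sout ⊆ St ∧
  St \ W = Sout \ W ∧
  (∀ s ∈ Sout ∩ W, IsLeafOf G W s) ∧
  (∀ s ∈ St, s ∉ W → Pt s = P s ∧ Pt s ∩ W = ∅) ∧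
  (∀ s ∈ Sout ∩ W, P s ⊆ Pt s ∧ Pt s \ P s ⊆ W) ∧
  (∀ s ∈ St, s ∉ Sout → Pt s ⊆ W)

/-- The partial sink configuration `(Sout, P)` is optimal relative to the working tree on `W`. -/
def OptimalRelative (G : SimpleGraph V) (f : Set V → V → ℝ≥0∞) (𝒯 : ℝ≥0∞)
    (W : Set V) (Sout : Set V) (P : V → Set V) : Prop :=
  ∃ (St : Set V) (Pt : V → Set V), WitnessesOptimality G f 𝒯 W Sout P St Pt

theorem mem_reachSet_iff_exists_walk {G : SimpleGraph V} {A : Set V} {u y : V} :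
    y ∈ reachSet G A u ↔ ∃ p : G.Walk u y, ∀ z ∈ p.support, z ∈ A := by
  constructor
  · rintro ⟨hu, hy, ⟨p⟩⟩
    refine ⟨p.map (SimpleGraph.Embedding.induce A).toHom, fun z hz => ?_⟩
    obtain ⟨z, -, rfl⟩ := List.mem_map.1 (Walk.support_map _ p ▸ hz)
    exact z.2
  · rintro ⟨p, hp⟩
    exact ⟨hp _ p.start_mem_support, hp _ p.end_mem_support, ⟨p.induce A hp⟩⟩

theorem mem_reachSet_self {G : SimpleGraph V} {A : Set V} {u : V} (hu : u ∈ A) :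
    u ∈ reachSet G A u :=
  ⟨hu, hu, Reachable.rfl⟩

theorem reachSet_subset (G : SimpleGraph V) (A : Set V) (u : V) : reachSet G A u ⊆ A :=
  fun _ ⟨_, hy, _⟩ => hy

theorem mem_reachSet_symm {G : SimpleGraph V} {A : Set V} {u y : V}
    (h : y ∈ reachSet G A u) : u ∈ reachSet G A y :=
  let ⟨hu, hy, p⟩ := h
  ⟨hy, hu, p.symm⟩

theorem mem_reachSet_trans {G : SimpleGraph V} {A : Set V} {u y z : V}
    (h : y ∈ reachSet G A u) (h' : z ∈ reachSet G A y) : z ∈ reachSet G A u :=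
  let ⟨hu, _, p⟩ := h
  let ⟨_, hz, q⟩ := h'
  ⟨hu, hz, p.trans q⟩

theorem mem_reachSet_of_adj {G : SimpleGraph V} {A : Set V} {u y : V}
    (hu : u ∈ A) (hy : y ∈ A) (h : G.Adj u y) : y ∈ reachSet G A u :=
  ⟨hu, hy, Adj.reachable (by simpa using h)⟩

theorem reachSet_mono {G : SimpleGraph V} {A B : Set V} (h : A ⊆ B) (u : V) :
    reachSet G A u ⊆ reachSet G B u := by
  intro y hy
  rw [mem_reachSet_iff_exists_walk] at hy ⊢
  obtain ⟨p, hp⟩ := hy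
  exact ⟨p, fun z hz => h (hp z hz)⟩

theorem mem_reachSet_of_subset {G : SimpleGraph V} {A B : Set V} {u y : V}
    (hy : y ∈ reachSet G A u) (h : reachSet G A u ⊆ B) : y ∈ reachSet G B u := by
  classical
  rw [mem_reachSet_iff_exists_walk] at hy ⊢
  obtain ⟨p, hp⟩ := hy
  refine ⟨p, fun z hz => h ?_⟩
  rw [mem_reachSet_iff_exists_walk]
  exact ⟨p.takeUntil z hz, fun a ha => hp a (p.support_takeUntil_subset_support hz ha)⟩

theorem isSubtree_reachSet {G : SimpleGraph V} {A : Set V} {u : V} (hu : u ∈ A) :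
    IsSubtree G (reachSet G A u) := by
  rw [IsSubtree, connected_iff_exists_forall_reachable]
  refine ⟨⟨u, mem_reachSet_self hu⟩, fun ⟨y, hy⟩ => ?_⟩
  obtain ⟨_, _, h⟩ := mem_reachSet_of_subset hy Subset.rfl
  exact h

/-- In an acyclic graph no vertex reaches each end of an edge while avoiding the other end. -/
theorem SimpleGraph.IsAcyclic.notMem_reachSet_of_adj {G : SimpleGraph V} (hG : G.IsAcyclic)
    {A : Set V} {a w η : V} (hadj : G.Adj w η) (hη : η ∈ reachSet G (A \ {w}) a) :
    w ∉ reachSet G (A \ {η}) a := by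
  classical
  intro hw
  rw [mem_reachSet_iff_exists_walk] at hη hw
  obtain ⟨q, hq⟩ := hη
  obtain ⟨p, hp⟩ := hw
  have hpη : η ∉ p.bypass.support := fun h => (hp η (p.support_bypass_subset_support h)).2 rfl
  have hqw : w ∉ q.bypass.support := fun h => (hq w (q.support_bypass_subset_support h)).2 rfl
  have h := (hG.subsingleton_path a η).elim
    ⟨p.bypass.concat hadj, p.bypass_isPath.concat hpη hadj⟩ ⟨q.bypass, q.bypass_isPath⟩
  rw [Subtype.mk.injEq] at h
  apply hqw
  rw [← h, Walk.support_concat]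
  simp

/-- Deleting an unreachable vertex does not affect reachability. -/
theorem mem_reachSet_diff_of_notMem {G : SimpleGraph V} {A : Set V} {a w y : V}
    (hw : w ∉ reachSet G A a) (hy : y ∈ reachSet G A a) : y ∈ reachSet G (A \ {w}) a :=
  mem_reachSet_of_subset hy fun _ hz =>
    ⟨reachSet_subset _ _ _ hz, fun h => hw (h ▸ hz)⟩

theorem exists_adj_mem_reachSet_diff {G : SimpleGraph V} {A : Set V} {x η : V}
    (h : η ∈ reachSet G A x) (hne : x ≠ η) :
    ∃ x', G.Adj x' η ∧ x' ∈ reachSet G (A \ {η}) x := by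
  rw [mem_reachSet_iff_exists_walk] at h
  obtain ⟨p, hp⟩ := h
  induction p with
  | nil => exact absurd rfl hne
  | @cons u v t huv p ih =>
    have hu : u ∈ A \ {t} := ⟨hp u (by simp), hne⟩
    by_cases hvt : v = t
    · subst hvt
      exact ⟨u, huv, mem_reachSet_self hu⟩
    · obtain ⟨x', hx', hr⟩ := ih hvt fun z hz => hp z (by simp [hz])
      have hv : v ∈ A \ {t} := ⟨hp v (by simp), hvt⟩
      exact ⟨x', hx', mem_reachSet_trans (mem_reachSet_of_adj hu hv huv) hr⟩

theorem reachSet_eq_of_mem {G : SimpleGraph V} {A : Set V} {x y : V}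
    (h : y ∈ reachSet G A x) : reachSet G A y = reachSet G A x :=
  Subset.antisymm (fun _ hz => mem_reachSet_trans h hz)
    fun _ hz => mem_reachSet_trans (mem_reachSet_symm h) hz

/-- A branch at `η` that contains a vertex beyond `η` as seen from `w` lies beyond `η`. -/
theorem reachSet_subset_branch {G : SimpleGraph V} (hG : G.IsAcyclic) {W : Set V} {w η x : V}
    (hadj : G.Adj w η)
    (hx : x ∈ reachSet G (W \ {w}) η) :
    reachSet G (W \ {η}) x ⊆ reachSet G (W \ {w}) η \ {η} := by
  intro y hy
  refine ⟨mem_reachSet_trans hx ?_, (reachSet_subset _ _ _ hy).2⟩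
  have hw := hG.notMem_reachSet_of_adj hadj (mem_reachSet_symm hx)
  refine reachSet_mono ?_ x (mem_reachSet_diff_of_notMem hw hy)
  exact fun z hz => ⟨hz.1.1, hz.2⟩

/-- Without peaking pairs, every branch of the tree free of sinks has cost at most `𝒯`. -/
theorem cost_branch_le [Finite V] {G : SimpleGraph V} (hG : G.IsAcyclic)
    {f : Set V → V → ℝ≥0∞} (hf : IsMinmaxMonotone G f) {𝒯 : ℝ≥0∞} {W S : Set V}
    (hnopeak : ∀ u v : V, ¬ PeakingPair G f 𝒯 W S u v) {w η : V} (hw : w ∈ W) (hη : η ∈ W)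
    (hadj : G.Adj w η) (hS : S ∩ reachSet G (W \ {w}) η = ∅) :
    f (reachSet G (W \ {w}) η ∪ {w}) w ≤ 𝒯 := by
  induction h : (reachSet G (W \ {w}) η).ncard using Nat.strong_induction_on
    generalizing w η with
  | _ n ih =>
  subst h
  by_contra! hlt
  refine hnopeak η w ⟨hη, hw, hadj.symm, hS, ?_, hlt⟩
  have hηA : η ∈ W \ {w} := ⟨hη, hadj.ne'⟩
  have hηB := mem_reachSet_self (G := G) hηA
  rw [hf.max_comp _ η (isSubtree_reachSet hηA) hηB]
  refine iSup₂_le fun x ⟨hxB, hxη⟩ => ?_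
  have hreach : η ∈ reachSet G (reachSet G (W \ {w}) η) x := by
    apply mem_reachSet_symm
    exact mem_reachSet_of_subset hxB Subset.rfl
  obtain ⟨x', hx'η, hx'⟩ := exists_adj_mem_reachSet_diff hreach hxη
  have hx'B := reachSet_subset _ _ _ hx'
  have hsub := reachSet_subset_branch hG hadj hx'B.1
  have heq : reachSet G (reachSet G (W \ {w}) η \ {η}) x = reachSet G (W \ {η}) x' := by
    rw [← reachSet_eq_of_mem hx']
    refine Subset.antisymm (reachSet_mono ?_ x') fun y hy => mem_reachSet_of_subset hy hsub
    exact fun z hz => ⟨(reachSet_subset _ _ _ hz.1).1, hz.2⟩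
  rw [heq]
  refine ih _ (ncard_lt_ncard ?_ (toFinite _)) hη (reachSet_subset _ _ _ hx'B.1).1 hx'η.symm ?_ rfl
  · exact ⟨fun y hy => (hsub hy).1, fun hall => (hsub (hall hηB)).2 rfl⟩
  · exact subset_eq_empty (inter_subset_inter_right S fun y hy => (hsub hy).1) hS

/-- Outstanding branches contain no sinks. -/
theorem inter_branch_eq_empty {G : SimpleGraph V} (hG : G.IsAcyclic) {W S : Set V}
    (hSW : S ⊆ W) {r w η : V} (hw : w ∈ hubVerts G W S r) (hη : η ∈ W) (hadj : G.Adj w η)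
    (hηhub : η ∉ hubVerts G W S r) : S ∩ reachSet G (W \ {w}) η = ∅ := by
  obtain ⟨t, htS, htW, hrW, -, htr⟩ := hw
  have hreach : ∀ s ∈ S, r ∈ reachSet G (W \ {η}) s := fun s hs => by
    by_contra hr
    exact hηhub ⟨s, hs, hSW hs, hrW, hη, hr⟩
  have hdiff : (W \ {η}) \ {w} ⊆ W \ {w} := fun z hz => ⟨hz.1.1, hz.2⟩
  rw [eq_empty_iff_forall_notMem]
  rintro s ⟨hsS, hsB⟩
  have hws := hG.notMem_reachSet_of_adj hadj (mem_reachSet_symm hsB)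
  have hrs := reachSet_mono hdiff s (mem_reachSet_diff_of_notMem hws (hreach s hsS))
  have hwr := hG.notMem_reachSet_of_adj hadj
    (mem_reachSet_symm (mem_reachSet_trans hsB hrs))
  have hwt : w ∉ reachSet G (W \ {η}) t := fun h =>
    hwr (mem_reachSet_trans (mem_reachSet_symm (hreach t htS)) h)
  exact htr (reachSet_mono hdiff t (mem_reachSet_diff_of_notMem hwt (hreach t htS)))

/-- Lemma `RCViability`: if no ordered pair satisfies the peaking criterion,
then the working tree is RC-viable with respect to `S`. -/
theorem statement_5 [Fintype V] (G : SimpleGraph V) (hG : G.IsTree)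
    (f : Set V → V → ℝ≥0∞) (hf : IsMinmaxMonotone G f) (𝒯 : ℝ≥0∞)
    (W S : Set V) (hW : IsSubtree G W) (hSW : S ⊆ W)
    (hSleaf : ∀ s ∈ S, IsLeafOf G W s)
    (r : V) (hS2 : 2 ≤ S.ncard) (hW2 : 2 < W.ncard) (hroot : GoodRoot G W S r)
    (hnopeak : ∀ u v : V, ¬ PeakingPair G f 𝒯 W S u v) :
    RCViable G f 𝒯 W S r := by
  intro w hw η hη hadj hηhub
  obtain ⟨-, -, -, -, hwW, -⟩ := id hw
  exact cost_branch_le hG.isAcyclic hf hnopeak hwW hη hadj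
    (inter_branch_eq_empty hG.isAcyclic hSW hw hη hadj hηhub)
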